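/- There is no continuous open surjection from C_p([0,1]) onto C_p([0,1]^ℕ); in particular, the unit interval [0,1] and the Hilbert cube [0,1]^ℕ are not t-equivalent. -/

import Mathlib

/-- `Cp X` is the space `C(X, ℝ)` of continuous real-valued functions on `X`,
topologized as a subspace of the product `X → ℝ`, i.e. with the topology of
pointwise convergence. -/
def Cp (X : Type*) [TopologicalSpace X] : Type _ := {f : X → ℝ // Continuous f}

instance (X : Type*) [TopologicalSpace X] : TopologicalSpace (Cp X) :=
  inferInstanceAs (TopologicalSpace {f : X → ℝ // Continuous f})

namespace HC
open Finset

def up (b : ℕ → ℕ) (i : ℕ) : ℕ → ℕ := Function.update b i (b i + 1)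

lemma up_comm (b : ℕ → ℕ) (i j : ℕ) (h : i ≠ j) : up (up b i) j = up (up b j) i := by
  unfold up
  rw [Function.update_of_ne h.symm, Function.update_of_ne h, Function.update_comm h]

def FF : List ((ℕ → ℕ) → ZMod 2) → Finset ℕ → (ℕ → ℕ) → ZMod 2
  | [], _, _ => 1
  | s :: l, S, b => ∑ i ∈ S, (s (up b i) + s b) * FF l (S.erase i) (up b i)

lemma symm_sum (S : Finset ℕ) (g : ℕ → ℕ → ZMod 2) (hg : ∀ i j, i ≠ j → g i j = g j i) :
    ∑ j ∈ S, ∑ i ∈ S.erase j, g j i = 0 := by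
  rw [Finset.sum_sigma']
  refine Finset.sum_involution (fun a _ => ⟨a.2, a.1⟩) ?_ ?_ ?_ ?_
  · rintro ⟨j, i⟩ h
    simp only [Finset.mem_sigma, Finset.mem_erase] at h
    simp only
    rw [hg i j h.2.1]
    exact CharTwo.add_self_eq_zero _
  · rintro ⟨j, i⟩ h _ h2
    simp only [Finset.mem_sigma, Finset.mem_erase] at h
    simp only [Sigma.mk.injEq] at h2
    exact h.2.1 h2.1
  · rintro ⟨j, i⟩ h
    simp only [Finset.mem_sigma, Finset.mem_erase] at h ⊢
    exact ⟨h.2.2, Ne.symm h.2.1, h.1⟩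
  · rintro ⟨j, i⟩ h
    rfl

lemma swap_sum (S : Finset ℕ) (g : ℕ → ℕ → ZMod 2) :
    ∑ j ∈ S, ∑ i ∈ S.erase j, g j i = ∑ j ∈ S, ∑ i ∈ S.erase j, g i j := by
  refine Finset.sum_comm' ?_
  intro x y
  simp only [Finset.mem_erase]
  tauto

lemma FF_closed (l : List ((ℕ → ℕ) → ZMod 2)) : ∀ (S : Finset ℕ) (b : ℕ → ℕ),
    ∑ j ∈ S, (FF l (S.erase j) (up b j) + FF l (S.erase j) b) = 0 := by
  induction l with
  | nil =>
    intro S b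
    refine Finset.sum_eq_zero fun j _ => ?_
    exact CharTwo.add_self_eq_zero _
  | cons s l ih =>
    intro S b
    have e1 : ∑ j ∈ S, ∑ i ∈ S.erase j,
        s (up (up b j) i) * FF l ((S.erase j).erase i) (up (up b j) i) = 0 := by
      refine symm_sum S (fun j i => s (up (up b j) i) *
        FF l ((S.erase j).erase i) (up (up b j) i)) ?_
      intro i j h
      rw [up_comm b i j h, Finset.erase_right_comm]
    have e2 : ∑ j ∈ S, ∑ i ∈ S.erase j, (s (up b j) *
        FF l ((S.erase j).erase i) (up (up b j) i) +
        s (up b j) * FF l ((S.erase j).erase i) (up b j)) = 0 := by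
      refine Finset.sum_eq_zero fun j _ => ?_
      simp_rw [← mul_add]
      rw [← Finset.mul_sum, ih (S.erase j) (up b j), mul_zero]
    have e3 : ∑ j ∈ S, ∑ i ∈ S.erase j, (s b * FF l ((S.erase j).erase i) (up b i)
        + s b * FF l ((S.erase j).erase i) b) = 0 := by
      refine Finset.sum_eq_zero fun j _ => ?_
      simp_rw [← mul_add]
      rw [← Finset.mul_sum, ih (S.erase j) b, mul_zero]
    have e4 : ∑ j ∈ S, ∑ i ∈ S.erase j, s b * FF l ((S.erase j).erase i) b = 0 := by
      refine symm_sum S (fun j i => s b * FF l ((S.erase j).erase i) b) ?_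
      intro i j h
      rw [Finset.erase_right_comm]
    have e5 : ∑ j ∈ S, ∑ i ∈ S.erase j, s (up b j) * FF l ((S.erase j).erase i) (up b j)
      = ∑ j ∈ S, ∑ i ∈ S.erase j, s (up b i) * FF l ((S.erase j).erase i) (up b i) := by
      rw [swap_sum]
      refine Finset.sum_congr rfl fun j _ => Finset.sum_congr rfl fun i _ => ?_
      rw [Finset.erase_right_comm]
    simp only [FF, add_mul, Finset.sum_add_distrib] at *
    rw [e1, zero_add, ← e5, ← add_assoc, e2, zero_add]
    rw [e4, add_zero] at e3
    exact e3

lemma FF_stokes (s : (ℕ → ℕ) → ZMod 2) (l : List ((ℕ → ℕ) → ZMod 2)) (S : Finset ℕ) (b : ℕ → ℕ) :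
    FF (s :: l) S b = ∑ i ∈ S, (s (up b i) * FF l (S.erase i) (up b i)
      + s b * FF l (S.erase i) b) := by
  have h := FF_closed l S b
  have h2 : ∑ i ∈ S, (s b * FF l (S.erase i) (up b i) + s b * FF l (S.erase i) b) = 0 := by
    simp_rw [← mul_add]
    rw [← Finset.mul_sum, h, mul_zero]
  simp only [FF, add_mul, Finset.sum_add_distrib] at *
  rw [CharTwo.add_eq_zero.mp h2]

lemma FF_zero (s : (ℕ → ℕ) → ZMod 2) (v : ZMod 2) (l : List ((ℕ → ℕ) → ZMod 2)) (hs : s ∈ l) :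
    ∀ (S : Finset ℕ) (c : ℕ → ℕ),
    (∀ c' : ℕ → ℕ, (∀ j, j ∉ S → c' j = c j) → (∀ j, c' j = c j ∨ c' j = c j + 1) → s c' = v) →
    FF l S c = 0 := by
  induction l with
  | nil => simp at hs
  | cons a l ih =>
    intro S c hc
    rw [FF]
    refine Finset.sum_eq_zero fun i hi => ?_
    have hup : ∀ j, j ≠ i → up c i j = c j := fun j hj => Function.update_of_ne hj _ _
    have hupi : up c i i = c i + 1 := Function.update_self _ _ _
    rcases List.mem_cons.mp hs with rfl | hs
    · rw [hc (up c i), hc c, CharTwo.add_self_eq_zero, zero_mul]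
      · intros; rfl
      · intros; left; rfl
      · intro j hj; apply hup; rintro rfl; exact hj hi
      · intro j
        by_cases h : j = i
        · subst h; right; exact hupi
        · left; exact hup j h
    · rw [ih hs, mul_zero]
      intro c' h1 h2
      apply hc
      · intro j hj
        have hji : j ≠ i := by rintro rfl; exact hj hi
        rw [h1 j (fun h => hj (Finset.mem_of_mem_erase h)), hup j hji]
      · intro j
        by_cases h : j = i
        · subst h
          right; rw [h1 j (by simp), hupi]
        · have := h2 j
          rwa [hup j h] at this

def BS (K : ℕ) : List ℕ → ((ℕ → ℕ) → ZMod 2) → (ℕ → ℕ) → ZMod 2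
  | [], g, b => g b
  | j :: L, g, b => ∑ t ∈ range K, BS K L g (Function.update b j t)

lemma BS_congr (K : ℕ) (L : List ℕ) (g g' : (ℕ → ℕ) → ZMod 2) : ∀ b,
    (∀ c : ℕ → ℕ, (∀ j, j ∉ L → c j = b j) → g c = g' c) → BS K L g b = BS K L g' b := by
  induction L with
  | nil => intro b h; exact h b (fun _ _ => rfl)
  | cons j L ih =>
    intro b h
    refine Finset.sum_congr rfl fun t _ => ih _ fun c hc => h c fun k hk => ?_
    rw [List.mem_cons, not_or] at hk
    rw [hc k hk.2, Function.update_of_ne hk.1]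

lemma BS_zero (K : ℕ) (L : List ℕ) : ∀ b, BS K L (fun _ => 0) b = 0 := by
  induction L with
  | nil => intro b; rfl
  | cons j L ih => intro b; exact Finset.sum_eq_zero fun t _ => ih _

lemma BS_add (K : ℕ) (L : List ℕ) (g g' : (ℕ → ℕ) → ZMod 2) : ∀ b,
    BS K L (fun c => g c + g' c) b = BS K L g b + BS K L g' b := by
  induction L with
  | nil => intro b; rfl
  | cons j L ih =>
    intro b
    simp only [BS, ih, Finset.sum_add_distrib]

lemma BS_sum (K : ℕ) (L : List ℕ) (S : Finset ℕ) (g : ℕ → (ℕ → ℕ) → ZMod 2) : ∀ b,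
    BS K L (fun c => ∑ i ∈ S, g i c) b = ∑ i ∈ S, BS K L (g i) b := by
  induction L with
  | nil => intro b; rfl
  | cons j L ih =>
    intro b
    simp only [BS, ih]
    exact Finset.sum_comm

lemma BS_shift (K : ℕ) (L : List ℕ) (i : ℕ) (hi : i ∉ L) (g : (ℕ → ℕ) → ZMod 2) : ∀ b,
    BS K L (fun c => g (up c i)) b = BS K L g (up b i) := by
  induction L with
  | nil => intro b; rfl
  | cons j L ih =>
    intro b
    rw [List.mem_cons, not_or] at hi
    simp only [BS]
    refine Finset.sum_congr rfl fun t _ => ?_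
    rw [ih hi.2]
    congr 1
    unfold up
    rw [Function.update_of_ne hi.1, Function.update_comm hi.1]

lemma tele (K : ℕ) (u : ℕ → ZMod 2) : ∑ t ∈ range K, (u (t+1) + u t) = u K + u 0 := by
  induction K with
  | zero => simp [CharTwo.add_self_eq_zero]
  | succ n ih =>
    rw [Finset.sum_range_succ, ih]
    have := CharTwo.add_self_eq_zero (u n)
    linear_combination this

lemma BS_tele (K : ℕ) (L : List ℕ) (i : ℕ) (hi : i ∉ L) (h : (ℕ → ℕ) → ZMod 2) (b : ℕ → ℕ) :
    BS K (i :: L) (fun c => h (up c i) + h c) b =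
      BS K L h (Function.update b i K) + BS K L h (Function.update b i 0) := by
  simp only [BS, BS_add, BS_shift K L i hi]
  rw [← tele K (fun t => BS K L h (Function.update b i t))]
  refine Finset.sum_congr rfl fun t _ => ?_
  simp [up]

lemma BS_bdry (K : ℕ) (i : ℕ) (h : (ℕ → ℕ) → ZMod 2)
    (hh : ∀ c : ℕ → ℕ, c i = 0 ∨ c i = K → h c = 0) (L : List ℕ) (hn : L.Nodup) (hi : i ∈ L) :
    ∀ b, BS K L (fun c => h (up c i) + h c) b = 0 := by
  induction L with
  | nil => simp at hi
  | cons j L ih =>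
    intro b
    rw [List.nodup_cons] at hn
    by_cases hij : i = j
    · subst hij
      rw [BS_tele K L i hn.1]
      have h1 : ∀ t, t = 0 ∨ t = K → BS K L h (Function.update b i t) = 0 := by
        intro t ht
        rw [BS_congr K L h (fun _ => 0), BS_zero]
        intro c hc
        apply hh
        rw [hc i hn.1, Function.update_self]
        exact ht
      rw [h1 K (Or.inr rfl), h1 0 (Or.inl rfl), add_zero]
    · have : i ∈ L := by
        rcases List.mem_cons.mp hi with h | h
        · exact absurd h hij
        · exact h
      exact Finset.sum_eq_zero fun t _ => ih hn.2 this _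

def lst (s : ℕ → (ℕ → ℕ) → ZMod 2) : ℕ → List ((ℕ → ℕ) → ZMod 2)
  | 0 => []
  | m + 1 => s m :: lst s m

def dirs : ℕ → List ℕ
  | 0 => []
  | m + 1 => m :: dirs m

lemma mem_dirs (m i : ℕ) : i ∈ dirs m ↔ i < m := by
  induction m with
  | zero => simp [dirs]
  | succ m ih => simp [dirs, ih]; omega

lemma nodup_dirs (m : ℕ) : (dirs m).Nodup := by
  induction m with
  | zero => simp [dirs]
  | succ m ih => simp [dirs, ih, mem_dirs]

lemma mem_lst (s : ℕ → (ℕ → ℕ) → ZMod 2) (m i : ℕ) (h : i < m) : s i ∈ lst s m := by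
  induction m with
  | zero => omega
  | succ m ih =>
    rw [lst, List.mem_cons]
    by_cases him : i = m
    · left; rw [him]
    · right; exact ih (by omega)

lemma deg (N K : ℕ) (s : ℕ → (ℕ → ℕ) → ZMod 2)
    (h0 : ∀ i < N, ∀ b : ℕ → ℕ, b i = 0 → s i b = 0)
    (h1 : ∀ i < N, ∀ b : ℕ → ℕ, b i = K → s i b = 1) :
    ∀ m ≤ N, ∀ b, BS K (dirs m) (FF (lst s m) (range m)) b = 1 := by
  intro m
  induction m with
  | zero => intro _ b; rfl
  | succ m ih =>
    intro hm b
    have ih := ih (by omega)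
    rw [lst, dirs]
    have e : FF (s m :: lst s m) (range (m+1)) = fun c => ∑ i ∈ range (m+1),
      (s m (up c i) * FF (lst s m) ((range (m+1)).erase i) (up c i)
      + s m c * FF (lst s m) ((range (m+1)).erase i) c) := by
      funext c; exact FF_stokes _ _ _ _
    rw [e, BS_sum, Finset.sum_range_succ, Finset.sum_eq_zero, zero_add]
    · have hnm : m ∉ dirs m := by rw [mem_dirs]; omega
      have hr : (range (m+1)).erase m = range m := by
        ext x; simp; omega
      rw [BS_tele K (dirs m) m hnm (fun c => s m c * FF (lst s m) ((range (m+1)).erase m) c), hr]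
      rw [BS_congr K (dirs m) _ (FF (lst s m) (range m)) (Function.update b m K), ih]
      · rw [BS_congr K (dirs m) _ (fun _ => 0), BS_zero, add_zero]
        intro c hc
        rw [h0 m (by omega) c, zero_mul]
        rw [hc m hnm, Function.update_self]
      · intro c hc
        rw [h1 m (by omega) c, one_mul]
        rw [hc m hnm, Function.update_self]
    · intro i hi
      rw [Finset.mem_range] at hi
      refine BS_bdry K i (fun c => s m c * FF (lst s m) ((range (m+1)).erase i) c) ?_ _
        (nodup_dirs (m+1)) ((mem_dirs _ _).2 (by omega)) b
      intro c hc
      rcases hc with hc | hc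
      · rw [FF_zero (s i) 0 _ (mem_lst s m i hi), mul_zero]
        intro c' h2 _
        apply h0 i (by omega)
        rw [h2 i (by simp), hc]
      · rw [FF_zero (s i) 1 _ (mem_lst s m i hi), mul_zero]
        intro c' h2 _
        apply h1 i (by omega)
        rw [h2 i (by simp), hc]

theorem comb (N K : ℕ) (s : ℕ → (ℕ → ℕ) → ZMod 2)
    (h0 : ∀ i < N, ∀ b : ℕ → ℕ, b i = 0 → s i b = 0)
    (h1 : ∀ i < N, ∀ b : ℕ → ℕ, b i = K → s i b = 1)
    (h : ∀ b : ℕ → ℕ, ∃ i < N, ∃ v, ∀ c : ℕ → ℕ, (∀ j, c j = b j ∨ c j = b j + 1) → s i c = v) :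
    False := by
  have h2 := deg N K s h0 h1 N le_rfl (fun _ => 0)
  rw [BS_congr K _ _ (fun _ => 0), BS_zero] at h2
  · exact zero_ne_one h2
  · intro c _
    obtain ⟨i, hi, v, hv⟩ := h c
    exact FF_zero (s i) v _ (mem_lst s N i hi) _ _ fun c' _ hc' => hv c' hc'

end HC


namespace HC
open Topology Set
local notation "I" => unitInterval

theorem cube (N : ℕ) (V W : Fin N → Set (Fin N → I)) (hV : ∀ i, IsOpen (V i))
    (hW : ∀ i, IsOpen (W i)) (hd : ∀ i, Disjoint (V i) (W i))
    (h0 : ∀ i x, x i = 0 → x ∈ V i) (h1 : ∀ i x, x i = 1 → x ∈ W i)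
    (hc : ∀ x, ∃ i, x ∈ V i ∪ W i) : False := by
  classical
  obtain ⟨δ, hδ, hb⟩ := lebesgue_number_lemma_of_metric (s := (univ : Set (Fin N → I)))
    (c := Sum.elim V W) isCompact_univ (by rintro (i | i); exacts [hV i, hW i])
    (by
      intro x _
      obtain ⟨i, hi | hi⟩ := hc x
      · exact mem_iUnion.2 ⟨Sum.inl i, hi⟩
      · exact mem_iUnion.2 ⟨Sum.inr i, hi⟩)
  obtain ⟨K, hK⟩ := exists_nat_one_div_lt hδ
  have hKpos : (0 : ℝ) < K + 1 := by positivity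
  let pt : (ℕ → ℕ) → (Fin N → I) := fun b i => projIcc 0 1 zero_le_one ((b i : ℝ) / (K + 1))
  let s : ℕ → (ℕ → ℕ) → ZMod 2 := fun i b =>
    if h : i < N then (if pt b ∈ V ⟨i, h⟩ then 0 else 1) else 0
  refine comb N (K + 1) s ?_ ?_ ?_
  · intro i hi b hbi
    have : pt b ∈ V ⟨i, hi⟩ := by
      apply h0
      simp [pt, hbi]
    simp [s, hi, this]
  · intro i hi b hbi
    have : pt b ∈ W ⟨i, hi⟩ := by
      apply h1
      simp only [pt, hbi]
      push_cast
      rw [div_self hKpos.ne', projIcc_right]; rfl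
    have h2 : pt b ∉ V ⟨i, hi⟩ := fun h => (Set.disjoint_left.1 (hd _)) h this
    simp [s, hi, h2]
  · intro b
    have key : ∀ c : ℕ → ℕ, (∀ j, c j = b j ∨ c j = b j + 1) → pt c ∈ Metric.ball (pt b) δ := by
      intro c hcb
      rw [Metric.mem_ball, dist_pi_lt_iff hδ]
      intro j
      refine lt_of_le_of_lt ?_ hK
      rw [Subtype.dist_eq, Real.dist_eq]
      refine le_trans (Set.abs_projIcc_sub_projIcc zero_le_one) ?_
      rw [← sub_div, abs_div, abs_of_pos hKpos]
      gcongr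
      rcases hcb j with h | h <;> simp [h]
    obtain ⟨i | i, hi⟩ := hb (pt b) (mem_univ _)
    · refine ⟨i, i.2, 0, fun c hcb => ?_⟩
      have : pt c ∈ V i := hi (key c hcb)
      simp [s, this]
    · refine ⟨i, i.2, 1, fun c hcb => ?_⟩
      have : pt c ∈ W i := hi (key c hcb)
      have h2 : pt c ∉ V i := fun h => (Set.disjoint_left.1 (hd _)) h this
      simp [s, h2]

theorem hcube (V W : ℕ → Set (ℕ → I)) (hV : ∀ i, IsOpen (V i))
    (hW : ∀ i, IsOpen (W i)) (hd : ∀ i, Disjoint (V i) (W i))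
    (h0 : ∀ i x, x i = 0 → x ∈ V i) (h1 : ∀ i x, x i = 1 → x ∈ W i)
    (hc : ∀ x, ∃ i, x ∈ V i ∪ W i) : False := by
  obtain ⟨t, ht⟩ := isCompact_univ.elim_finite_subcover (fun i => V i ∪ W i)
    (fun i => (hV i).union (hW i)) (fun x _ => mem_iUnion.2 (hc x))
  let N := t.sup id + 1
  have hN : ∀ i ∈ t, i < N := fun i hi => Nat.lt_succ_of_le (Finset.le_sup (f := id) hi)
  let e : (Fin N → I) → (ℕ → I) := fun x i => if h : i < N then x ⟨i, h⟩ else 0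
  have he : Continuous e := by
    refine continuous_pi fun i => ?_
    by_cases h : i < N
    · simp only [e, h, dif_pos]; exact continuous_apply _
    · simp only [e, h, dif_neg, not_false_iff]; exact continuous_const
  have hei : ∀ x (i : Fin N), e x i = x i := fun x i => by simp [e]
  refine cube N (fun i => e ⁻¹' V i) (fun i => e ⁻¹' W i) (fun i => (hV i).preimage he)
    (fun i => (hW i).preimage he) (fun i => (hd i).preimage e) ?_ ?_ ?_
  · intro i x hx; exact h0 i _ (by rw [hei, hx])
  · intro i x hx; exact h1 i _ (by rw [hei, hx])
  · intro x
    obtain ⟨i, hi, hx⟩ := mem_iUnion₂.1 (ht (mem_univ (e x)))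
    exact ⟨⟨i, hN i hi⟩, hx⟩

lemma clopen_sep {Z : Type*} [TopologicalSpace Z] [SecondCountableTopology Z] (C : Z → Set Z)
    (hC : ∀ z, IsClopen (C z)) (hz : ∀ z, z ∈ C z) (p : Z → Prop) :
    ∃ D : Set Z, IsClopen D ∧ (∀ x ∈ D, ∃ z, p z ∧ x ∈ C z) ∧
      (∀ x ∉ D, ∃ z, ¬ p z ∧ x ∈ C z) := by
  classical
  rcases isEmpty_or_nonempty Z with hE | hE
  · exact ⟨∅, isClopen_empty, fun x => (hE.false x).elim, fun x => (hE.false x).elim⟩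
  obtain ⟨t, htc, ht⟩ := TopologicalSpace.countable_cover_nhds
    (fun z => (hC z).isOpen.mem_nhds (hz z))
  have htn : t.Nonempty := by
    obtain ⟨x⟩ := hE
    have : x ∈ ⋃ z ∈ t, C z := ht ▸ mem_univ x
    obtain ⟨z, hzt, -⟩ := mem_iUnion₂.1 this
    exact ⟨z, hzt⟩
  obtain ⟨g, rfl⟩ := htc.exists_eq_range htn
  have hcov : ∀ x, ∃ n, x ∈ C (g n) := by
    intro x
    have : x ∈ ⋃ z ∈ range g, C z := ht ▸ mem_univ x
    obtain ⟨z, ⟨n, rfl⟩, h⟩ := mem_iUnion₂.1 this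
    exact ⟨n, h⟩
  let k : Z → ℕ := fun x => Nat.find (hcov x)
  have hk : IsLocallyConstant k := by
    rw [IsLocallyConstant.iff_isOpen_fiber]
    intro n
    have : k ⁻¹' {n} = C (g n) ∩ ⋂ m ∈ Finset.range n, (C (g m))ᶜ := by
      ext x
      simp [k, Nat.find_eq_iff]
    rw [this]
    refine (hC _).isOpen.inter ?_
    exact isOpen_biInter_finset fun m _ => (hC _).compl.isOpen
  refine ⟨k ⁻¹' {n | p (g n)}, ⟨⟨hk {n | p (g n)}ᶜ⟩, hk _⟩, ?_, ?_⟩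
  · intro x hx
    exact ⟨_, hx, Nat.find_spec (hcov x)⟩
  · intro x hx
    exact ⟨_, hx, Nat.find_spec (hcov x)⟩

lemma sep {Y : Type*} [TopologicalSpace Y] [CompletelyNormalSpace Y] [SecondCountableTopology Y]
    (Z : Set Y) (hZ : ∀ z : Z, ∀ O : Set Y, IsOpen O → (z : Y) ∈ O →
      ∃ C : Set Z, IsClopen C ∧ z ∈ C ∧ ∀ x ∈ C, (x : Y) ∈ O)
    (A B : Set Y) (hA : IsClosed A) (hB : IsClosed B) (hAB : Disjoint A B) :
    ∃ V W : Set Y, IsOpen V ∧ IsOpen W ∧ Disjoint V W ∧ A ⊆ V ∧ B ⊆ W ∧ Z ⊆ V ∪ W := by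
  classical
  obtain ⟨U, hU, hAU, hUB⟩ := normal_exists_closure_subset hA hB.isOpen_compl
    hAB.subset_compl_right
  obtain ⟨U2, hU2, hBU, hUU⟩ := normal_exists_closure_subset hB isClosed_closure.isOpen_compl
    (subset_compl_comm.1 hUB)
  have hex : ∀ z : Z, ∃ C : Set Z, IsClopen C ∧ z ∈ C ∧
      (((z : Y) ∉ closure U2 ∧ ∀ x ∈ C, (x : Y) ∉ U2) ∨
       ((z : Y) ∈ closure U2 ∧ ∀ x ∈ C, (x : Y) ∉ U)) := by
    intro z
    by_cases h : (z : Y) ∈ closure U2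
    · obtain ⟨C, h1, h2, h3⟩ := hZ z (closure U)ᶜ isClosed_closure.isOpen_compl (hUU h)
      exact ⟨C, h1, h2, Or.inr ⟨h, fun x hx hxU => h3 x hx (subset_closure hxU)⟩⟩
    · obtain ⟨C, h1, h2, h3⟩ := hZ z (closure U2)ᶜ isClosed_closure.isOpen_compl h
      exact ⟨C, h1, h2, Or.inl ⟨h, fun x hx hxU => h3 x hx (subset_closure hxU)⟩⟩
  choose C hC hzC hCp using hex
  obtain ⟨D, hD, hD1, hD2⟩ := clopen_sep C hC hzC (fun z => (z : Y) ∉ closure U2)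
  have hD1 : ∀ x ∈ D, (x : Y) ∉ U2 := by
    intro x hx
    obtain ⟨z, hz, hxz⟩ := hD1 x hx
    rcases hCp z with h | h
    · exact h.2 x hxz
    · exact absurd h.1 hz
  have hD2 : ∀ x ∉ D, (x : Y) ∉ U := by
    intro x hx
    obtain ⟨z, hz, hxz⟩ := hD2 x hx
    rcases hCp z with h | h
    · exact absurd h.1 hz
    · exact h.2 x hxz
  have aux : ∀ (S T : Set Y) (G : Set Z) (O : Set Y), IsClosed S → Disjoint S T → IsClosed G →
      IsOpen O → T ⊆ O → (∀ x ∈ G, (x : Y) ∉ O) → (∀ x ∉ G, (x : Y) ∉ S) →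
      Disjoint (closure (S ∪ Subtype.val '' G)) (T ∪ Subtype.val '' Gᶜ) := by
    intro S T G O hS hST hG hO hTO h1 h2
    rw [closure_union, hS.closure_eq, Set.disjoint_left]
    rintro y (hy | hy) (hy2 | ⟨x, hx, rfl⟩)
    · exact Set.disjoint_left.1 hST hy hy2
    · exact h2 x hx hy
    · obtain ⟨w, hw1, ⟨x, hx, rfl⟩⟩ := mem_closure_iff.1 hy O hO (hTO hy2)
      exact h1 x hx hw1
    · rw [← closure_subtype, hG.closure_eq] at hy
      exact hx hy
  have d1 := aux A B D U2 hA hAB hD.isClosed hU2 hBU hD1 (fun x hx h => hD2 x hx (hAU h))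
  have d2 := aux B A Dᶜ U hB hAB.symm hD.compl.isClosed hU hAU (fun x hx => hD2 x hx)
    (fun x hx h => hD1 x (not_not.1 hx) (hBU h))
  rw [compl_compl] at d2
  obtain ⟨V, W, hV, hW, hSV, hTW, hVW⟩ := separatedNhds_iff_disjoint.2
    (CompletelyNormalSpace.completely_normal d1 d2.symm)
  refine ⟨V, W, hV, hW, hVW, fun x hx => hSV (Or.inl hx), fun x hx => hTW (Or.inl hx), ?_⟩
  intro x hx
  by_cases h : (⟨x, hx⟩ : Z) ∈ D
  · exact Or.inl (hSV (Or.inr ⟨_, h, rfl⟩))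
  · exact Or.inr (hTW (Or.inr ⟨_, h, rfl⟩))

end HC

namespace HC
open Topology Set
local notation "I" => unitInterval

def TT : Option ℚ → Set I
  | none => {x | Irrational (x : ℝ)}
  | some q => {x | (x : ℝ) = q}

lemma TT_cover (x : I) : ∃ c, x ∈ TT c := by
  by_cases h : Irrational (x : ℝ)
  · exact ⟨none, h⟩
  · unfold Irrational at h
    rw [not_not] at h
    obtain ⟨q, hq⟩ := h
    exact ⟨some q, hq.symm⟩

lemma thin (c : Option ℚ) (x : I) (hx : x ∈ TT c) (ε : ℝ) (hε : 0 < ε) :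
    ∃ B : Set I, IsOpen B ∧ x ∈ B ∧ B ⊆ Metric.ball x ε ∧ closure B ∩ TT c ⊆ B := by
  cases c with
  | some q =>
    refine ⟨Metric.ball x ε, Metric.isOpen_ball, Metric.mem_ball_self hε, subset_rfl, ?_⟩
    rintro y ⟨-, hy⟩
    have : y = x := Subtype.ext (hy.trans hx.symm)
    rw [this]; exact Metric.mem_ball_self hε
  | none =>
    obtain ⟨a, ha1, ha2⟩ := exists_rat_btwn (sub_lt_self (x : ℝ) hε)
    obtain ⟨b, hb1, hb2⟩ := exists_rat_btwn (lt_add_of_pos_right (x : ℝ) hε)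
    refine ⟨Subtype.val ⁻¹' Ioo (a : ℝ) b, isOpen_Ioo.preimage continuous_subtype_val,
      ⟨ha2, hb1⟩, ?_, ?_⟩
    · rintro y ⟨h1, h2⟩
      rw [Metric.mem_ball, Subtype.dist_eq, Real.dist_eq, abs_lt]
      constructor <;> linarith
    · rintro y ⟨h1, h2⟩
      have h3 : y ∈ Subtype.val ⁻¹' Icc (a : ℝ) b :=
        closure_minimal (preimage_mono Ioo_subset_Icc_self)
          (isClosed_Icc.preimage continuous_subtype_val) h1
      have h2 : Irrational (y : ℝ) := h2
      exact ⟨lt_of_le_of_ne h3.1 (h2.ne_rat a).symm, lt_of_le_of_ne h3.2 (h2.ne_rat b)⟩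

lemma thin_pi {n : ℕ} (c : Fin n → Option ℚ) (A : Fin n → I) (hA : ∀ j, A j ∈ TT (c j))
    (N : Set (Fin n → I)) (hN : N ∈ 𝓝 A) :
    ∃ B : Set (Fin n → I), IsOpen B ∧ A ∈ B ∧ B ⊆ N ∧
      ∀ x ∈ closure B, (∀ j, x j ∈ TT (c j)) → x ∈ B := by
  obtain ⟨ε, hε, hb⟩ := Metric.mem_nhds_iff.1 hN
  choose B h1 h2 h3 h4 using fun j => thin (c j) (A j) (hA j) ε hε
  refine ⟨pi univ B, isOpen_set_pi finite_univ (fun j _ => h1 j), fun j _ => h2 j, ?_, ?_⟩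
  · intro x hx
    apply hb
    rw [Metric.mem_ball, dist_pi_lt_iff hε]
    exact fun j => h3 j (hx j trivial)
  · intro x hx hxT j _
    rw [closure_pi_set] at hx
    exact h4 j ⟨hx j trivial, hxT j⟩

def ZZ {n : ℕ} (E : Set ((ℕ → I) × (Fin n → I))) (R : Set (Fin n → I))
    (c : Fin n → Option ℚ) : Set (ℕ → I) :=
  {y | ∃ A, (y, A) ∈ E ∧ A ∈ R ∧ (∀ B ∈ R, (y, B) ∈ E → B = A) ∧ ∀ j, A j ∈ TT (c j)}

lemma ZZ_zero {n : ℕ} (E : Set ((ℕ → I) × (Fin n → I))) (hE : IsClosed E)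
    (hfin : ∀ A, {y | (y, A) ∈ E}.Finite) (R : Set (Fin n → I)) (hR : IsClosed R)
    (c : Fin n → Option ℚ) (z : ZZ E R c) (O : Set (ℕ → I)) (hO : IsOpen O) (hz : (z : ℕ → I) ∈ O) :
    ∃ C : Set (ZZ E R c), IsClopen C ∧ z ∈ C ∧ ∀ x ∈ C, (x : ℕ → I) ∈ O := by
  choose s s1 s2 s3 s4 using fun w : ZZ E R c => w.2
  have hs : Continuous s := by
    rw [continuous_iff_isClosed]
    intro F hF
    have : s ⁻¹' F = Prod.fst '' {p : ZZ E R c × (Fin n → I) |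
        ((p.1 : ℕ → I), p.2) ∈ E ∧ p.2 ∈ R ∧ p.2 ∈ F} := by
      ext w
      constructor
      · intro hw
        exact ⟨(w, s w), ⟨s1 w, s2 w, hw⟩, rfl⟩
      · rintro ⟨⟨w, A⟩, ⟨h1, h2, h3⟩, rfl⟩
        rw [mem_preimage, ← s3 w A h2 h1]
        exact h3
    rw [this]
    apply isClosedMap_fst_of_compactSpace
    refine (hE.preimage (by fun_prop)).inter ((hR.preimage continuous_snd).inter
      (hF.preimage continuous_snd))
  obtain ⟨P, hPo, hzP, hPO⟩ : ∃ P : Set (ℕ → I), IsOpen P ∧ (z : ℕ → I) ∈ P ∧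
      closure P ⊆ O ∩ ({y | (y, s z) ∈ E} \ {(z : ℕ → I)})ᶜ := by
    have h : O ∩ ({y | (y, s z) ∈ E} \ {(z : ℕ → I)})ᶜ ∈ 𝓝 (z : ℕ → I) :=
      (hO.inter ((hfin _).subset sdiff_subset).isClosed.isOpen_compl).mem_nhds ⟨hz, by simp⟩
    obtain ⟨P, h1, h2, h3⟩ := (TopologicalSpace.isTopologicalBasis_opens).exists_closure_subset h
    exact ⟨P, h1, h2, h3⟩
  let Fr : Set (Fin n → I) := Prod.snd '' (E ∩ Prod.fst ⁻¹' (frontier P))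
  have hFr : IsClosed Fr := isClosedMap_snd_of_compactSpace _
    (hE.inter (isClosed_frontier.preimage continuous_fst))
  have hsz : s z ∉ Fr := by
    rintro ⟨⟨y, A⟩, ⟨h1, h2⟩, rfl : A = s z⟩
    have h3 := (hPO (frontier_subset_closure h2)).2
    have h2 : y ∈ frontier P := h2
    have h4 : y = z := by
      by_contra hne
      exact h3 ⟨h1, hne⟩
    rw [hPo.frontier_eq, h4] at h2
    exact h2.2 hzP
  obtain ⟨B, hBo, hzB, hBF, hBT⟩ := thin_pi c (s z) (s4 z) Frᶜ (hFr.isOpen_compl.mem_nhds hsz)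
  refine ⟨{w | (w : ℕ → I) ∈ P ∧ s w ∈ B}, ⟨?_, ?_⟩, ⟨hzP, hzB⟩,
    fun x hx => (hPO (subset_closure hx.1)).1⟩
  · have : {w : ZZ E R c | (w : ℕ → I) ∈ P ∧ s w ∈ B} =
        {w : ZZ E R c | (w : ℕ → I) ∈ closure P ∧ s w ∈ closure B} := by
      ext w
      constructor
      · rintro ⟨h1, h2⟩; exact ⟨subset_closure h1, subset_closure h2⟩
      · rintro ⟨h1, h2⟩
        have h3 := hBT _ h2 (s4 w)
        refine ⟨?_, h3⟩
        by_contra h4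
        refine hBF h3 ⟨(w, s w), ⟨s1 w, ?_⟩, rfl⟩
        rw [mem_preimage, hPo.frontier_eq]
        exact ⟨h1, h4⟩
    rw [this]
    exact (isClosed_closure.preimage continuous_subtype_val).inter (isClosed_closure.preimage hs)
  · exact (hPo.preimage continuous_subtype_val).inter (hBo.preimage hs)

theorem no_relation {n : ℕ} (E : Set ((ℕ → I) × (Fin n → I))) (hE : IsClosed E)
    (hfin : ∀ A, {y | (y, A) ∈ E}.Finite)
    (hiso : ∀ y, ∃ A, (y, A) ∈ E ∧ ∃ N ∈ 𝓝 A, ∀ B ∈ N, (y, B) ∈ E → B = A) : False := by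
  obtain ⟨bs, hbc, -, hbb⟩ := TopologicalSpace.exists_countable_basis (Fin n → I)
  have : Countable bs := hbc.to_subtype
  have hne : Nonempty (bs × (Fin n → Option ℚ)) := by
    obtain ⟨A, -, -⟩ := hiso (fun _ => 0)
    obtain ⟨t, ht, -⟩ := hbb.exists_closure_subset (Filter.univ_mem (f := 𝓝 A))
    exact ⟨⟨t, ht⟩, fun _ => none⟩
  obtain ⟨g, hg⟩ := exists_surjective_nat (bs × (Fin n → Option ℚ))
  have hsep := fun k : ℕ => sep (ZZ E (closure (g k).1.1) (g k).2)
    (ZZ_zero E hE hfin _ isClosed_closure _)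
    {x | x k = 0} {x | x k = 1} (isClosed_eq (continuous_apply k) continuous_const)
    (isClosed_eq (continuous_apply k) continuous_const)
    (by
      rw [Set.disjoint_left]
      intro x (h1 : x k = 0) (h2 : x k = 1)
      exact zero_ne_one (h1.symm.trans h2))
  choose V W hV hW hVW h0 h1 hZ using hsep
  refine hcube V W hV hW hVW (fun i x hx => h0 i hx) (fun i x hx => h1 i hx) ?_
  intro y
  obtain ⟨A, hA, N, hN, hNA⟩ := hiso y
  obtain ⟨t, ht, hAt, htN⟩ := hbb.exists_closure_subset hN
  choose c hc using fun j => TT_cover (A j)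
  obtain ⟨k, hk⟩ := hg (⟨t, ht⟩, c)
  refine ⟨k, hZ k ?_⟩
  rw [hk]
  exact ⟨A, hA, subset_closure hAt, fun B hB hBE => hNA B (htN hB) hBE, hc⟩

end HC

namespace HC
open Topology Set
local notation "I" => unitInterval

lemma Cp_basis {X : Type*} [TopologicalSpace X] (O : Set (Cp X)) (hO : IsOpen O) (f : Cp X)
    (hf : f ∈ O) : ∃ (F : Finset X) (ε : ℝ), 0 < ε ∧
      ∀ g : Cp X, (∀ x ∈ F, |g.1 x - f.1 x| < ε) → g ∈ O := by
  obtain ⟨O', hO', rfl⟩ := isOpen_induced_iff.1 hO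
  obtain ⟨F, u, hu, hsub⟩ := isOpen_pi_iff.1 hO' f.1 hf
  have h : ∀ᶠ ε in 𝓝[>] (0 : ℝ), ∀ x ∈ F, Metric.ball (f.1 x) ε ⊆ u x := by
    rw [Filter.eventually_all_finset]
    intro x hx
    obtain ⟨ε, hε, hb⟩ := Metric.isOpen_iff.1 (hu x hx).1 _ (hu x hx).2
    filter_upwards [Ioo_mem_nhdsGT hε] with e he
    exact (Metric.ball_subset_ball he.2.le).trans hb
  obtain ⟨ε, h1, h2⟩ := (h.and self_mem_nhdsWithin).exists
  refine ⟨F, ε, h2, fun g hg => hsub fun x hx => h1 x hx ?_⟩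
  rw [Metric.mem_ball, Real.dist_eq]
  exact hg x hx

lemma Cp_eval {X : Type*} [TopologicalSpace X] (x : X) : Continuous fun f : Cp X => f.1 x :=
  (continuous_apply x).comp continuous_subtype_val

lemma Cp_interp {X : Type*} [TopologicalSpace X] [NormalSpace X] [T1Space X] (F : Finset X)
    (v : X → ℝ) : ∃ f : Cp X, ∀ x ∈ F, f.1 x = v x := by
  obtain ⟨g, hg⟩ := ContinuousMap.exists_restrict_eq (s := (F : Set X)) F.finite_toSet.isClosed
    (⟨fun x => v x, continuous_of_discreteTopology⟩ : C((F : Set X), ℝ))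
  refine ⟨⟨g, g.continuous⟩, fun x hx => ?_⟩
  exact DFunLike.congr_fun hg ⟨x, hx⟩

def EE (Φ : Cp I → Cp (ℕ → I)) (f0 : Cp I) (δ : ℝ) (n : ℕ) : Set ((ℕ → I) × (Fin n → I)) :=
  {p | ∀ f : Cp I, (∀ j, |f.1 (p.2 j) - f0.1 (p.2 j)| < δ) →
    |(Φ f).1 p.1 - (Φ f0).1 p.1| ≤ 1}

lemma EE_closed (Φ : Cp I → Cp (ℕ → I)) (f0 : Cp I) (δ : ℝ) (n : ℕ) :
    IsClosed (EE Φ f0 δ n) := by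
  have : EE Φ f0 δ n = ⋂ f : Cp I, ({p | ∀ j, |f.1 (p.2 j) - f0.1 (p.2 j)| < δ}ᶜ ∪
      {p | |(Φ f).1 p.1 - (Φ f0).1 p.1| ≤ 1}) := by
    ext p
    simp only [EE, mem_setOf_eq, mem_iInter, mem_union, mem_compl_iff, imp_iff_not_or]
  rw [this]
  refine isClosed_iInter fun f => IsClosed.union ?_ ?_
  · rw [isClosed_compl_iff, setOf_forall]
    refine isOpen_iInter_of_finite fun j => ?_
    have h1 := f.2
    have h2 := f0.2
    exact isOpen_lt (by fun_prop) continuous_const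
  · have h1 := (Φ f).2
    have h2 := (Φ f0).2
    exact isClosed_le (by fun_prop) continuous_const

lemma EE_fin (Φ : Cp I → Cp (ℕ → I)) (ho : IsOpenMap Φ) (f0 : Cp I) (δ : ℝ) (hδ : 0 < δ) (n : ℕ)
    (A : Fin n → I) : {y | (y, A) ∈ EE Φ f0 δ n}.Finite := by
  classical
  let O : Set (Cp I) := {f | ∀ j, |f.1 (A j) - f0.1 (A j)| < δ}
  have hO : IsOpen O := by
    have : O = ⋂ j, {f : Cp I | |f.1 (A j) - f0.1 (A j)| < δ} := by ext f; simp [O]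
    rw [this]
    refine isOpen_iInter_of_finite fun j => ?_
    exact isOpen_lt ((Cp_eval (A j)).sub continuous_const).abs continuous_const
  obtain ⟨F, ε, hε, hF⟩ := Cp_basis (Φ '' O) (ho O hO) (Φ f0)
    ⟨f0, fun j => by simpa using hδ, rfl⟩
  refine F.finite_toSet.subset fun y hy => ?_
  by_contra hyF
  obtain ⟨g, hg⟩ := Cp_interp (insert y F)
    (fun x => if x = y then (Φ f0).1 y + 2 else (Φ f0).1 x)
  obtain ⟨f, hfO, hfg⟩ := hF g (by
    intro x hx
    have hxy : x ≠ y := by rintro rfl; exact hyF hx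
    rw [hg x (Finset.mem_insert_of_mem hx), if_neg hxy]
    simpa using hε)
  have h1 : |(Φ f).1 y - (Φ f0).1 y| ≤ 1 := hy f hfO
  rw [hfg, hg y (Finset.mem_insert_self _ _), if_pos rfl] at h1
  norm_num at h1

lemma EE_cover (Φ : Cp I → Cp (ℕ → I)) (hc : Continuous Φ) (f0 : Cp I) (y : ℕ → I) :
    ∃ (n m : ℕ) (A : Fin n → I), (y, A) ∈ EE Φ f0 (1 / ((m : ℝ) + 1)) n := by
  have hO : IsOpen {f : Cp I | |(Φ f).1 y - (Φ f0).1 y| < 1} :=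
    isOpen_lt ((((Cp_eval y).comp hc).sub continuous_const).abs) continuous_const
  obtain ⟨F, ε, hε, hF⟩ := Cp_basis _ hO f0 (by simp)
  obtain ⟨m, hm⟩ := exists_nat_one_div_lt hε
  refine ⟨F.card, m, fun j => (F.equivFin.symm j).1, fun f hf => (hF f fun x hx => ?_).le⟩
  have := hf (F.equivFin ⟨x, hx⟩)
  simp only [Equiv.symm_apply_apply] at this
  exact this.trans hm

lemma EE_iso (Φ : Cp I → Cp (ℕ → I)) (hc : Continuous Φ) (f0 : Cp I) (δ : ℝ) (hδ : 0 < δ) (k : ℕ)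
    (y : ℕ → I) (A : Fin (k+1) → I)
    (hA : ∀ N ∈ 𝓝 A, ∃ B ∈ N, (y, B) ∈ EE Φ f0 δ (k+1) ∧ B ≠ A) :
    ∃ A' : Fin k → I, (y, A') ∈ EE Φ f0 δ k := by
  classical
  have hne : (𝓝 A ⊓ Filter.principal {B | (y, B) ∈ EE Φ f0 δ (k+1) ∧ B ≠ A}).NeBot := by
    rw [Filter.inf_principal_neBot_iff]
    intro N hN
    obtain ⟨B, h1, h2⟩ := hA N hN
    exact ⟨B, h1, h2⟩
  let U := Ultrafilter.of (𝓝 A ⊓ Filter.principal {B | (y, B) ∈ EE Φ f0 δ (k+1) ∧ B ≠ A})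
  have hU := Ultrafilter.of_le (𝓝 A ⊓ Filter.principal {B | (y, B) ∈ EE Φ f0 δ (k+1) ∧ B ≠ A})
  have hU1 : (U : Filter (Fin (k+1) → I)) ≤ 𝓝 A := hU.trans inf_le_left
  have hU2 : ∀ᶠ B in (U : Filter (Fin (k+1) → I)), (y, B) ∈ EE Φ f0 δ (k+1) ∧ B ≠ A :=
    Filter.le_principal_iff.1 (hU.trans inf_le_right)
  obtain ⟨j0, hj0⟩ : ∃ j0, ∀ᶠ B in (U : Filter (Fin (k+1) → I)), B j0 ≠ A j0 := by
    by_contra hcon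
    push Not at hcon
    have h1 : ∀ᶠ B in (U : Filter (Fin (k+1) → I)), ∀ j, B j = A j := by
      rw [Filter.eventually_all]
      intro j
      have := hcon j
      rw [← Ultrafilter.frequently_iff_eventually]
      simpa using this
    obtain ⟨B, h1, h2⟩ := (h1.and hU2).exists
    exact h2.2 (funext h1)
  refine ⟨fun i => A (j0.succAbove i), ?_⟩
  intro f hf
  by_contra hcon
  rw [not_le] at hcon
  have hO : IsOpen {f : Cp I | 1 < |(Φ f).1 y - (Φ f0).1 y|} :=
    isOpen_lt continuous_const ((((Cp_eval y).comp hc).sub continuous_const).abs)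
  obtain ⟨F, ε, hε, hF⟩ := Cp_basis _ hO f hcon
  let F' : Finset I := F ∪ Finset.univ.image A
  have hev : ∀ᶠ B in (U : Filter (Fin (k+1) → I)), ∀ j, B j = A j ∨ B j ∉ F' := by
    rw [Filter.eventually_all]
    intro j
    apply hU1
    have h1 : ((F'.erase (A j) : Finset I) : Set I)ᶜ ∈ 𝓝 (A j) :=
      (F'.erase (A j)).finite_toSet.isClosed.isOpen_compl.mem_nhds (by simp)
    filter_upwards [(continuous_apply j).continuousAt h1] with B hB
    by_contra! h2
    exact hB (Finset.mem_coe.2 (Finset.mem_erase.2 h2))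
  obtain ⟨B, ⟨hB1, -⟩, hB2, hB3⟩ := (hU2.and (hj0.and hev)).exists
  obtain ⟨g, hg⟩ := Cp_interp (F ∪ Finset.univ.image B) (fun x => if x ∈ F' then f.1 x else f0.1 x)
  have h1 : 1 < |(Φ g).1 y - (Φ f0).1 y| := hF g (by
    intro x hx
    rw [hg x (Finset.mem_union_left _ hx), if_pos (Finset.mem_union_left _ hx)]
    simpa using hε)
  have h2 : |(Φ g).1 y - (Φ f0).1 y| ≤ 1 := hB1 g (by
    intro j
    change |g.1 (B j) - f0.1 (B j)| < δ
    rw [hg (B j) (Finset.mem_union_right _ (Finset.mem_image_of_mem _ (Finset.mem_univ _)))]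
    rcases hB3 j with h | h
    · have hj : j ≠ j0 := by rintro rfl; exact hB2 h
      obtain ⟨i, rfl⟩ := Fin.exists_succAbove_eq hj
      rw [h, if_pos (Finset.mem_union_right _ (Finset.mem_image_of_mem _ (Finset.mem_univ _)))]
      exact hf i
    · rw [if_neg h]
      simpa using hδ)
  exact absurd h1 (not_lt.2 h2)

theorem main (Φ : Cp I → Cp (ℕ → I)) (hc : Continuous Φ) (ho : IsOpenMap Φ) : False := by
  classical
  let f0 : Cp I := ⟨fun _ => 0, continuous_const⟩
  let P : ℕ → ℕ → Set (ℕ → I) := fun m n => {y | ∃ A, (y, A) ∈ EE Φ f0 (1 / ((m : ℝ) + 1)) n}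
  have hP : ∀ m n, IsClosed (P m n) := by
    intro m n
    have : P m n = Prod.fst '' EE Φ f0 (1 / ((m : ℝ) + 1)) n := by
      ext y; simp [P]
    rw [this]
    exact isClosedMap_fst_of_compactSpace _ (EE_closed _ _ _ _)
  obtain ⟨⟨m, n'⟩, hmn⟩ := nonempty_interior_of_iUnion_of_closed
    (f := fun p : ℕ × ℕ => P p.1 p.2) (fun p => hP _ _) (by
      rw [eq_univ_iff_forall]
      intro y
      obtain ⟨n, m, A, hA⟩ := EE_cover Φ hc f0 y
      exact mem_iUnion.2 ⟨(m, n), A, hA⟩)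
  have hex : ∃ n, (interior (P m n)).Nonempty := ⟨n', hmn⟩
  obtain ⟨n, hn, hmin⟩ : ∃ n, (interior (P m n)).Nonempty ∧
      ∀ k < n, ¬ (interior (P m k)).Nonempty :=
    ⟨Nat.find hex, Nat.find_spec hex, fun k hk => Nat.find_min hex hk⟩
  have hδ : (0 : ℝ) < 1 / ((m : ℝ) + 1) := by positivity
  obtain ⟨U, hU, ⟨y0, hy0⟩, hUP, hUk⟩ : ∃ U : Set (ℕ → I), IsOpen U ∧ U.Nonempty ∧ U ⊆ P m n ∧
      ∀ k, n = k + 1 → ∀ y ∈ U, y ∉ P m k := by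
    rcases n with _ | k
    · exact ⟨_, isOpen_interior, hn, interior_subset, fun k hk => by omega⟩
    · refine ⟨interior (P m (k+1)) \ P m k, isOpen_interior.sdiff (hP m k), ?_,
        sdiff_subset.trans interior_subset, ?_⟩
      · by_contra hcon
        rw [not_nonempty_iff_eq_empty, diff_eq_empty] at hcon
        exact hmin k (by omega) (hn.mono (interior_maximal hcon isOpen_interior))
      · intro k' hk' y hy
        obtain rfl : k = k' := by omega
        exact hy.2
  obtain ⟨J, u, hu, hsub⟩ := isOpen_pi_iff.1 hU y0 hy0
  let M := J.sup id + 1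
  have hM : ∀ i ∈ J, i < M := fun i hi => Nat.lt_succ_of_le (Finset.le_sup (f := id) hi)
  let e : (ℕ → I) → (ℕ → I) := fun x i => if i < M then y0 i else x (i - M)
  have he : Continuous e := by
    refine continuous_pi fun i => ?_
    by_cases h : i < M
    · simp only [e, h, if_true]; exact continuous_const
    · simp only [e, h, if_false]; exact continuous_apply _
  have hinj : Function.Injective e := by
    intro x x' h
    funext i
    have := congrFun h (i + M)
    simpa [e] using this
  have heU : ∀ x, e x ∈ U := by
    intro x
    apply hsub
    intro i hi
    simp only [e, hM i hi, if_true]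
    exact (hu i hi).2
  refine no_relation (n := n) {p | (e p.1, p.2) ∈ EE Φ f0 (1 / ((m : ℝ) + 1)) n} ?_ ?_ ?_
  · exact (EE_closed _ _ _ _).preimage (by fun_prop)
  · intro A
    exact Set.Finite.preimage (f := e) hinj.injOn (EE_fin Φ ho f0 _ hδ n A)
  · intro x
    obtain ⟨A, hA⟩ := hUP (heU x)
    refine ⟨A, hA, ?_⟩
    by_contra hcon
    push Not at hcon
    rcases n with _ | k
    · obtain ⟨B, -, -, hB⟩ := hcon univ Filter.univ_mem
      exact hB (Subsingleton.elim _ _)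
    · exact hUk k rfl (e x) (heU x) (EE_iso Φ hc f0 _ hδ k (e x) A hcon)

end HC

/-- There is no continuous open surjection from `C_p([0,1])` onto `C_p([0,1]^ℕ)`;
in particular, `[0,1]` and the Hilbert cube `[0,1]^ℕ` are not t-equivalent. -/
theorem no_open_surjection_Cp_interval_to_Cp_hilbert_cube :
    (¬ ∃ Φ : Cp unitInterval → Cp (ℕ → unitInterval),
        Continuous Φ ∧ IsOpenMap Φ ∧ Function.Surjective Φ) ∧
    ¬ Nonempty (Cp unitInterval ≃ₜ Cp (ℕ → unitInterval)) := by
  constructor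
  · rintro ⟨Φ, hc, ho, -⟩
    exact HC.main Φ hc ho
  · rintro ⟨h⟩
    exact HC.main h h.continuous h.isOpenMap
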